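/- arXiv:2510.18924 — 2 statements merged into one kernel-verified Lean document; each statement's English description precedes it below -/
import Mathlib

section
/- Let Q be a finite nonempty type with probability mass function ρ : Q → ℝ, O a finite nonempty type, and r : Q → O → ℝ a reward taking values in {0,1}. Let π, π_k assign to each q a probability mass function on O, with p_π(q) = ∑_o π(q)(o)·r(q)(o) and p_k(q) = ∑_o π_k(q)(o)·r(q)(o). Let ρ⁺, ρ⁻ : Q → [0,1] satisfy ρ⁺(q) + ρ⁻(q) < 1 for all q, set μ_k(q) = ρ⁺(q) + (1 − ρ⁺(q) − ρ⁻(q))·p_k(q), assume 0 < μ_k(q) < 1 for all q, and set σ̃_k(q) = √(μ_k(q)(1 − μ_k(q))), L̃(q) = (1 − ρ⁺(q) − ρ⁻(q))·(p_π(q) − p_k(q))/σ̃_k(q), and TV(q) = (1/2)·∑_o |π(q)(o) − π_k(q)(o)|. Then ∑_q ρ(q)(p_π(q) − p_k(q)) ≥ ∑_q ρ(q)·L̃(q) − 2·√(∑_q ρ(q)·((1 − ρ⁺(q) − ρ⁻(q) − σ̃_k(q))/σ̃_k(q))²)·√(∑_q ρ(q)·TV(q)²). -/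
open Finset

theorem sum_weight_mul_le_sqrt_mul_sqrt {ι : Type*} (s : Finset ι) {w : ι → ℝ}
    (hw : ∀ i, 0 ≤ w i) (f g : ι → ℝ) :
    ∑ i ∈ s, w i * (f i * g i) ≤
      Real.sqrt (∑ i ∈ s, w i * f i ^ 2) * Real.sqrt (∑ i ∈ s, w i * g i ^ 2) := by
  have h := Real.sum_mul_le_sqrt_mul_sqrt s
    (fun i => Real.sqrt (w i) * f i) (fun i => Real.sqrt (w i) * g i)
  simp only [mul_pow, Real.sq_sqrt (hw _)] at h
  refine le_of_eq_of_le (Finset.sum_congr rfl fun i _ => ?_) h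
  rw [mul_mul_mul_comm, Real.mul_self_sqrt (hw i)]

theorem abs_sum_mul_sub_sum_mul_le {ι : Type*} (s : Finset ι) (p p' r : ι → ℝ)
    (hr : ∀ i, |r i| ≤ 1) :
    |∑ i ∈ s, p i * r i - ∑ i ∈ s, p' i * r i| ≤ ∑ i ∈ s, |p i - p' i| := by
  rw [← Finset.sum_sub_distrib]
  refine (Finset.abs_sum_le_sum_abs _ _).trans (Finset.sum_le_sum fun i _ => ?_)
  rw [← sub_mul, abs_mul]
  exact mul_le_of_le_one_right (abs_nonneg _) (hr i)

theorem noisy_grpo_policy_improvement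
    (Q O : Type*) [Fintype Q] [Nonempty Q] [Fintype O] [Nonempty O]
    (ρ : Q → ℝ) (hρ0 : ∀ q, 0 ≤ ρ q) (hρ1 : ∑ q, ρ q = 1)
    (r : Q → O → ℝ) (hr : ∀ q o, r q o = 0 ∨ r q o = 1)
    (π πk : Q → O → ℝ)
    (hπ0 : ∀ q o, 0 ≤ π q o) (hπ1 : ∀ q, ∑ o, π q o = 1)
    (hπk0 : ∀ q o, 0 ≤ πk q o) (hπk1 : ∀ q, ∑ o, πk q o = 1)
    (pπ pk : Q → ℝ)
    (hpπ : ∀ q, pπ q = ∑ o, π q o * r q o)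
    (hpk : ∀ q, pk q = ∑ o, πk q o * r q o)
    (ρp ρm : Q → ℝ)
    (hρp0 : ∀ q, 0 ≤ ρp q) (hρp1 : ∀ q, ρp q ≤ 1)
    (hρm0 : ∀ q, 0 ≤ ρm q) (hρm1 : ∀ q, ρm q ≤ 1)
    (hsum : ∀ q, ρp q + ρm q < 1)
    (μk : Q → ℝ) (hμk : ∀ q, μk q = ρp q + (1 - ρp q - ρm q) * pk q)
    (hμk0 : ∀ q, 0 < μk q) (hμk1 : ∀ q, μk q < 1)
    (σt L TV : Q → ℝ)
    (hσt : ∀ q, σt q = Real.sqrt (μk q * (1 - μk q)))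
    (hL : ∀ q, L q = (1 - ρp q - ρm q) * (pπ q - pk q) / σt q)
    (hTV : ∀ q, TV q = (1/2) * ∑ o, |π q o - πk q o|) :
    ∑ q, ρ q * (pπ q - pk q) ≥
      ∑ q, ρ q * L q
        - 2 * Real.sqrt (∑ q, ρ q * ((1 - ρp q - ρm q - σt q) / σt q) ^ 2)
            * Real.sqrt (∑ q, ρ q * (TV q) ^ 2) := by
  have hσ : ∀ q, 0 < σt q := fun q => by
    rw [hσt]
    exact Real.sqrt_pos.2 (mul_pos (hμk0 q) (sub_pos.2 (hμk1 q)))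
  have hgap : ∀ q, |pπ q - pk q| ≤ 2 * TV q := fun q => by
    have h := abs_sum_mul_sub_sum_mul_le univ (π q) (πk q) (r q)
      fun o => by rcases hr q o with h | h <;> simp [h]
    rw [hpπ, hpk, hTV]
    linarith
  have hterm : ∀ q, ρ q * L q - ρ q * (pπ q - pk q) ≤
      2 * (ρ q * (|(1 - ρp q - ρm q - σt q) / σt q| * TV q)) := fun q => by
    have hLq : L q - (pπ q - pk q) =
        (1 - ρp q - ρm q - σt q) / σt q * (pπ q - pk q) := by
      have := (hσ q).ne'
      rw [hL]
      field_simp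
    calc ρ q * L q - ρ q * (pπ q - pk q)
        = ρ q * ((1 - ρp q - ρm q - σt q) / σt q * (pπ q - pk q)) := by
          rw [← mul_sub, hLq]
      _ ≤ ρ q * (|(1 - ρp q - ρm q - σt q) / σt q| * (2 * TV q)) := by
          refine mul_le_mul_of_nonneg_left ((le_abs_self _).trans ?_) (hρ0 q)
          rw [abs_mul]
          exact mul_le_mul_of_nonneg_left (hgap q) (abs_nonneg _)
      _ = _ := by ring
  have hsum_le := Finset.sum_le_sum fun q (_ : q ∈ univ) => hterm q
  rw [Finset.sum_sub_distrib, ← Finset.mul_sum] at hsum_le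
  have hcs := sum_weight_mul_le_sqrt_mul_sqrt univ hρ0
    (fun q => |(1 - ρp q - ρm q - σt q) / σt q|) TV
  simp only [sq_abs] at hcs
  linarith
end

section
/- Let Q be a finite nonempty type with probability mass function ρ : Q → ℝ, O a finite nonempty type, and r : Q → O → ℝ a reward taking values in {0,1}. Let π, π_k assign to each q a probability mass function on O, with p_π(q) = ∑_o π(q)(o)·r(q)(o) and p_k(q) = ∑_o π_k(q)(o)·r(q)(o). Let ρ⁺, ρ⁻, ρ̂⁺, ρ̂⁻ : Q → [0,1] with s(q) := 1 − ρ⁺(q) − ρ⁻(q) > 0 and ŝ(q) := 1 − ρ̂⁺(q) − ρ̂⁻(q) > 0 for all q, let M : Q → ℝ be strictly positive, and set M'(q) = (ŝ(q)/s(q))·M(q). Define the surrogate with estimated rates L̂(q) = (s(q)/ŝ(q))·(p_π(q) − p_k(q))/M(q) and TV(q) = (1/2)·∑_o |π(q)(o) − π_k(q)(o)|. Then ∑_q ρ(q)(p_π(q) − p_k(q)) ≥ ∑_q ρ(q)·L̂(q) − 2·√(∑_q ρ(q)·((1 − M'(q))/M'(q))²)·√(∑_q ρ(q)·TV(q)²).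 -/
open Finset

/-- Weighted Cauchy–Schwarz inequality for finite sums with nonnegative weights. -/
theorem sum_weight_mul_mul_le_sqrt_mul_sqrt {ι : Type*} (t : Finset ι) {w : ι → ℝ}
    (hw : ∀ i, 0 ≤ w i) (f g : ι → ℝ) :
    ∑ i ∈ t, w i * (f i * g i) ≤
      Real.sqrt (∑ i ∈ t, w i * f i ^ 2) * Real.sqrt (∑ i ∈ t, w i * g i ^ 2) := by
  have h := Real.sum_mul_le_sqrt_mul_sqrt t (fun i => Real.sqrt (w i) * f i)
    (fun i => Real.sqrt (w i) * g i)
  simp only [mul_pow, Real.sq_sqrt (hw _)] at h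
  refine le_of_eq_of_le (Finset.sum_congr rfl fun i _ => ?_) h
  rw [mul_mul_mul_comm, Real.mul_self_sqrt (hw i)]

/-- The expectations of a function bounded by one differ by at most the `ℓ¹` distance. -/
theorem abs_sum_mul_sub_sum_mul_le_s18 {ι : Type*} (t : Finset ι) (a b : ι → ℝ) {f : ι → ℝ}
    (hf : ∀ i, |f i| ≤ 1) :
    |∑ i ∈ t, a i * f i - ∑ i ∈ t, b i * f i| ≤ ∑ i ∈ t, |a i - b i| := by
  rw [← Finset.sum_sub_distrib]
  refine (Finset.abs_sum_le_sum_abs _ _).trans (Finset.sum_le_sum fun i _ => ?_)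
  rw [← sub_mul, abs_mul]
  exact mul_le_of_le_one_right (abs_nonneg _) (hf i)

theorem estimated_rates_policy_improvement
    (Q O : Type*) [Fintype Q] [Nonempty Q] [Fintype O] [Nonempty O]
    (ρ : Q → ℝ) (hρ0 : ∀ q, 0 ≤ ρ q) (hρ1 : ∑ q, ρ q = 1)
    (r : Q → O → ℝ) (hr : ∀ q o, r q o = 0 ∨ r q o = 1)
    (π πk : Q → O → ℝ)
    (hπ0 : ∀ q o, 0 ≤ π q o) (hπ1 : ∀ q, ∑ o, π q o = 1)
    (hπk0 : ∀ q o, 0 ≤ πk q o) (hπk1 : ∀ q, ∑ o, πk q o = 1)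
    (pπ pk : Q → ℝ)
    (hpπ : ∀ q, pπ q = ∑ o, π q o * r q o)
    (hpk : ∀ q, pk q = ∑ o, πk q o * r q o)
    (ρp ρm ρph ρmh : Q → ℝ)
    (hρp0 : ∀ q, 0 ≤ ρp q) (hρp1 : ∀ q, ρp q ≤ 1)
    (hρm0 : ∀ q, 0 ≤ ρm q) (hρm1 : ∀ q, ρm q ≤ 1)
    (hρph0 : ∀ q, 0 ≤ ρph q) (hρph1 : ∀ q, ρph q ≤ 1)
    (hρmh0 : ∀ q, 0 ≤ ρmh q) (hρmh1 : ∀ q, ρmh q ≤ 1)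
    (s sh : Q → ℝ)
    (hsdef : ∀ q, s q = 1 - ρp q - ρm q) (hshdef : ∀ q, sh q = 1 - ρph q - ρmh q)
    (hspos : ∀ q, 0 < s q) (hshpos : ∀ q, 0 < sh q)
    (M M' : Q → ℝ) (hM : ∀ q, 0 < M q)
    (hM' : ∀ q, M' q = (sh q / s q) * M q)
    (L TV : Q → ℝ)
    (hL : ∀ q, L q = (s q / sh q) * (pπ q - pk q) / M q)
    (hTV : ∀ q, TV q = (1/2) * ∑ o, |π q o - πk q o|) :
    ∑ q, ρ q * (pπ q - pk q) ≥
      ∑ q, ρ q * L q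
        - 2 * Real.sqrt (∑ q, ρ q * ((1 - M' q) / M' q) ^ 2)
            * Real.sqrt (∑ q, ρ q * (TV q) ^ 2) := by
  have hgap (q : Q) : |pπ q - pk q| ≤ 2 * TV q := by
    have hr1 (o : O) : |r q o| ≤ 1 := by
      rcases hr q o with h | h <;> simp [h]
    have h := abs_sum_mul_sub_sum_mul_le_s18 univ (π q) (πk q) hr1
    rw [hpπ, hpk, hTV]
    linarith
  have hdiff (q : Q) : L q - (pπ q - pk q) = (1 - M' q) / M' q * (pπ q - pk q) := by
    have hs := (hspos q).ne'
    have hsh := (hshpos q).ne'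
    have hMq := (hM q).ne'
    rw [hL, hM']
    field_simp
  have hpoint (q : Q) :
      ρ q * L q - ρ q * (pπ q - pk q) ≤ 2 * (ρ q * (|(1 - M' q) / M' q| * TV q)) := by
    have h : L q - (pπ q - pk q) ≤ |(1 - M' q) / M' q| * (2 * TV q) := by
      rw [hdiff]
      refine (le_abs_self _).trans ?_
      rw [abs_mul]
      exact mul_le_mul_of_nonneg_left (hgap q) (abs_nonneg _)
    linarith [mul_le_mul_of_nonneg_left h (hρ0 q)]
  have hsum := Finset.sum_le_sum fun q (_ : q ∈ univ) => hpoint q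
  rw [Finset.sum_sub_distrib, ← Finset.mul_sum] at hsum
  have hcs := sum_weight_mul_mul_le_sqrt_mul_sqrt univ hρ0 (fun q => |(1 - M' q) / M' q|) TV
  simp only [sq_abs] at hcs
  linarith
end
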